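/- Let F(τ) = η(2τ)⁴/η(τ)⁴ for τ with Im τ > 0. For every a, b, c, d ∈ ℤ with ad − bc = 1 and c ≡ 0 (mod 2), there exists w ∈ ℂ with w⁶ = 1 such that F((aτ+b)/(cτ+d)) = w·F(τ) for all τ ∈ ℂ with Im τ > 0. -/

import Mathlib

/-- The Dedekind eta function `η(τ) = e^{πiτ/12} ∏_{n≥1} (1 - e^{2πinτ})`. -/
noncomputable def dedekindEta (τ : ℂ) : ℂ :=
  Complex.exp (Real.pi * Complex.I * τ / 12) *
    ∏' n : ℕ, (1 - Complex.exp (2 * Real.pi * Complex.I * (n + 1) * τ))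

/-- `F(τ) = η(2τ)⁴ / η(τ)⁴`. -/
noncomputable def F14 (τ : ℂ) : ℂ :=
  dedekindEta (2 * τ) ^ 4 / dedekindEta τ ^ 4

open Complex UpperHalfPlane MatrixGroups

theorem dedekindEta_eq_modularForm_eta : dedekindEta = ModularForm.eta := by
  ext τ
  simp only [dedekindEta, ModularForm.eta, ModularForm.eta_q_eq_cexp, Function.Periodic.qParam]
  congr 2
  push_cast
  ring

theorem dedekindEta_ne_zero {τ : ℂ} (hτ : 0 < τ.im) : dedekindEta τ ≠ 0 :=
  dedekindEta_eq_modularForm_eta ▸ ModularForm.eta_ne_zero hτ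

theorem continuousOn_dedekindEta : ContinuousOn dedekindEta {τ | 0 < τ.im} := fun _ hτ =>
  (dedekindEta_eq_modularForm_eta ▸
    ModularForm.differentiableAt_eta_of_mem_upperHalfPlaneSet hτ).continuousAt.continuousWithinAt

section Moebius

variable {a b c d : ℤ} {τ : ℂ}

/-- The coefficients `a b c d` of determinant one, as an element of `SL(2, ℤ)`. -/
def slOfDet (h : a * d - b * c = 1) : SL(2, ℤ) :=
  ⟨!![a, b; c, d], by rw [Matrix.det_fin_two_of, h]⟩

theorem coe_slOfDet_smul (h : a * d - b * c = 1) (hτ : 0 < τ.im) :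
    ((slOfDet h • (⟨τ, hτ⟩ : ℍ) : ℍ) : ℂ) = (a * τ + b) / (c * τ + d) := by
  rw [coe_specialLinearGroup_apply]
  simp [slOfDet]

theorem denom_slOfDet (h : a * d - b * c = 1) (hτ : 0 < τ.im) :
    denom (slOfDet h) (⟨τ, hτ⟩ : ℍ) = c * τ + d := by
  rw [ModularGroup.denom_apply]
  simp [slOfDet]

theorem moebius_im_pos (h : a * d - b * c = 1) (hτ : 0 < τ.im) :
    0 < ((a * τ + b) / (c * τ + d)).im :=
  coe_slOfDet_smul h hτ ▸ (slOfDet h • (⟨τ, hτ⟩ : ℍ)).im_pos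

theorem moebius_denom_ne_zero (h : a * d - b * c = 1) (hτ : 0 < τ.im) : c * τ + d ≠ 0 :=
  denom_slOfDet h hτ ▸ denom_ne_zero (slOfDet h) (⟨τ, hτ⟩ : ℍ)

theorem dedekindEta_moebius_pow (h : a * d - b * c = 1) (hτ : 0 < τ.im) :
    dedekindEta ((a * τ + b) / (c * τ + d)) ^ 24 = (c * τ + d) ^ 12 * dedekindEta τ ^ 24 := by
  have key := congrFun (SlashInvariantForm.slash_action_generators_SL2Z ModularForm.discriminant_S_invariant
    ModularForm.discriminant_T_invariant (slOfDet h)) ⟨τ, hτ⟩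
  rw [ModularForm.SL_slash_apply, denom_slOfDet, ModularForm.discriminant,
    ModularForm.discriminant, coe_slOfDet_smul, ← dedekindEta_eq_modularForm_eta] at key
  rw [← key, zpow_neg, ← div_eq_mul_inv]
  exact (mul_div_cancel₀ _ (pow_ne_zero 12 (moebius_denom_ne_zero h hτ))).symm

end Moebius

theorem two_mul_im_pos {τ : ℂ} (hτ : 0 < τ.im) : 0 < (2 * τ).im := by
  simpa using hτ

theorem F14_ne_zero {τ : ℂ} (hτ : 0 < τ.im) : F14 τ ≠ 0 :=
  div_ne_zero (pow_ne_zero _ (dedekindEta_ne_zero (two_mul_im_pos hτ)))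
    (pow_ne_zero _ (dedekindEta_ne_zero hτ))

theorem continuousOn_F14 : ContinuousOn F14 {τ | 0 < τ.im} :=
  ((continuousOn_dedekindEta.comp (by fun_prop) fun _ hτ => two_mul_im_pos hτ).pow 4).div
    (continuousOn_dedekindEta.pow 4) fun _ hτ => pow_ne_zero _ (dedekindEta_ne_zero hτ)

theorem F14_pow_six (τ : ℂ) : F14 τ ^ 6 = dedekindEta (2 * τ) ^ 24 / dedekindEta τ ^ 24 := by
  rw [F14, div_pow, ← pow_mul, ← pow_mul]

theorem F14_moebius_pow_six {a b c d : ℤ} {τ : ℂ} (h : a * d - b * c = 1) (hc : 2 ∣ c)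
    (hτ : 0 < τ.im) : F14 ((a * τ + b) / (c * τ + d)) ^ 6 = F14 τ ^ 6 := by
  obtain ⟨k, rfl⟩ := hc
  have h_conj : a * d - (2 * b) * k = 1 := by linear_combination h
  have h_double : 2 * ((a * τ + b) / (((2 * k : ℤ) : ℂ) * τ + d)) =
      (a * (2 * τ) + ((2 * b : ℤ) : ℂ)) / (k * (2 * τ) + d) := by
    push_cast
    ring
  have h_denom : (k : ℂ) * (2 * τ) + d = ((2 * k : ℤ) : ℂ) * τ + d := by
    push_cast
    ring
  rw [F14_pow_six, F14_pow_six, h_double, dedekindEta_moebius_pow h_conj (two_mul_im_pos hτ),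
    dedekindEta_moebius_pow h hτ, h_denom,
    mul_div_mul_left _ _ (pow_ne_zero _ (moebius_denom_ne_zero h hτ))]

theorem isDiscrete_setOf_pow_eq_one {n : ℕ} (hn : 0 < n) : IsDiscrete {w : ℂ | w ^ n = 1} := by
  have h_fin : {w : ℂ | w ^ n = 1}.Finite := by
    refine (Polynomial.nthRootsFinset n (1 : ℂ)).finite_toSet.subset fun w hw => ?_
    simpa [Polynomial.mem_nthRootsFinset hn] using hw
  exact h_fin.isDiscrete

/-- The span of `F(τ) = η(2τ)⁴/η(τ)⁴` is preserved, up to a sixth root of unity,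
by every element of `Γ₀(2)`. -/
theorem gamma0_2_invariance_14ABC (a b c d : ℤ) (h : a * d - b * c = 1) (hc : (2 : ℤ) ∣ c) :
    ∃ w : ℂ, w ^ 6 = 1 ∧ ∀ τ : ℂ, 0 < τ.im →
      F14 (((a : ℂ) * τ + (b : ℂ)) / ((c : ℂ) * τ + (d : ℂ))) = w * F14 τ := by
  have h_cont : ContinuousOn (fun τ : ℂ => F14 ((a * τ + b) / (c * τ + d)) / F14 τ)
      {τ | 0 < τ.im} := by
    refine (continuousOn_F14.comp (.div (by fun_prop) (by fun_prop) fun τ hτ => ?_)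
      fun τ hτ => ?_).div continuousOn_F14 fun τ hτ => F14_ne_zero hτ
    · exact moebius_denom_ne_zero h hτ
    · exact moebius_im_pos h hτ
  obtain ⟨w, hw, h_eq⟩ := (convex_halfSpace_im_gt 0).isPreconnected.eqOn_const_of_mapsTo
    (isDiscrete_setOf_pow_eq_one (n := 6) (by norm_num)) h_cont
    (fun τ hτ => by
      rw [Set.mem_ofPred_eq, div_pow, F14_moebius_pow_six h hc hτ,
        div_self (pow_ne_zero _ (F14_ne_zero hτ))])
    ⟨1, one_pow 6⟩
  exact ⟨w, hw, fun τ hτ => (div_eq_iff (F14_ne_zero hτ)).1 (h_eq hτ)⟩
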